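/- Let m ≥ 1, N ≥ 2, let b₁,…,b_N be holomorphic function germs at 0 ∈ ℂ with b_j(0)=0, and let g₂,…,g_N be holomorphic function germs at 0 ∈ ℂ². Define φ:(ℂ²,0)→ℂ^{N+1} by φ(u,t) = (u^m(1+b₁(t)), b₂(t)u^m + u^{m+1}g₂(u,t), …, b_N(t)u^m + u^{m+1}g_N(u,t), t). Then for every sequence (u_n,t_n)→(0,0) with u_n ≠ 0: (i) (1/(m(1+b₁(t_n))u_n^{m-1}))·(∂φ/∂u)(u_n,t_n) → e₁; (ii) (∂φ/∂t)(u_n,t_n) → e_{N+1}; and (iii) (1/(u_n^m(1+b₁(t_n))))·(φ(u_n,t_n) − t_n e_{N+1}) → e₁; where e₁ = (1,0,…,0) and e_{N+1} = (0,…,0,1) in ℂ^{N+1}. Consequently the limits of the tangent planes Dφ(u_n,t_n)(ℂ²) equal the plane spanned by e₁ and e_{N+1}, which contains both the tangent line to {0}×ℂ at 0 and the limit of the secant lines joining φ(u_n,t_n) to (0,…,0,t_n). -/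

import Mathlib

open Filter Topology

noncomputable section

/-- The deformed parametrization
`φ(u,t) = (u^m (1+b₁(t)), b₂(t)u^m + u^{m+1}g₂(u,t), …, b_N(t)u^m + u^{m+1}g_N(u,t), t)`
of a family of curve germs, written with the middle `N-1 = K` components indexed by
`Fin K`, so that `φ : ℂ² → ℂ^{K+2} = ℂ^{N+1}`. -/
def phi (K m : ℕ) (b₁ : ℂ → ℂ) (b : Fin K → ℂ → ℂ) (g : Fin K → ℂ × ℂ → ℂ)
    (p : ℂ × ℂ) : Fin (K + 2) → ℂ :=
  Fin.cons (p.1 ^ m * (1 + b₁ p.2))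
    (Fin.snoc (fun j : Fin K => b j p.2 * p.1 ^ m + p.1 ^ (m + 1) * g j p) p.2)

/-- `∂φ/∂u`. -/
def phiDu (K m : ℕ) (b₁ : ℂ → ℂ) (b : Fin K → ℂ → ℂ) (g : Fin K → ℂ × ℂ → ℂ)
    (p : ℂ × ℂ) : Fin (K + 2) → ℂ :=
  deriv (fun z : ℂ => phi K m b₁ b g (z, p.2)) p.1

/-- `∂φ/∂t`. -/
def phiDt (K m : ℕ) (b₁ : ℂ → ℂ) (b : Fin K → ℂ → ℂ) (g : Fin K → ℂ × ℂ → ℂ)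
    (p : ℂ × ℂ) : Fin (K + 2) → ℂ :=
  deriv (fun z : ℂ => phi K m b₁ b g (p.1, z)) p.2

/-- The first standard basis vector `e₁ = (1,0,…,0)` of `ℂ^{N+1}`. -/
def e₁ (K : ℕ) : Fin (K + 2) → ℂ := Pi.single 0 1

/-- The last standard basis vector `e_{N+1} = (0,…,0,1)` of `ℂ^{N+1}`. -/
def eLast (K : ℕ) : Fin (K + 2) → ℂ := Pi.single (Fin.last (K + 1)) 1

/-- The partial derivative of `phi` in `u` in coordinates. -/
lemma hasDerivAt_phi_fst {K m : ℕ} {b₁ : ℂ → ℂ} {b : Fin K → ℂ → ℂ} {g : Fin K → ℂ × ℂ → ℂ}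
    {p : ℂ × ℂ} (hg : ∀ j, DifferentiableAt ℂ (g j) p) :
    HasDerivAt (fun z : ℂ => phi K m b₁ b g (z, p.2))
      (Fin.cons (m * p.1 ^ (m - 1) * (1 + b₁ p.2))
        (Fin.snoc (fun j : Fin K => b j p.2 * (m * p.1 ^ (m - 1)) +
          ((m + 1 : ℕ) * p.1 ^ m * g j p + p.1 ^ (m + 1) * fderiv ℂ (g j) p (1, 0))) 0)) p.1 := by
  rw [hasDerivAt_pi]
  intro i
  refine Fin.cases ?_ (fun i => Fin.lastCases ?_ (fun j => ?_) i) i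
  · simpa [phi] using (hasDerivAt_pow m p.1).mul_const (1 + b₁ p.2)
  · simpa [phi] using hasDerivAt_const p.1 p.2
  · have hgj : HasDerivAt (fun z : ℂ => g j (z, p.2)) (fderiv ℂ (g j) p (1, 0)) p.1 :=
      (hg j).hasFDerivAt.comp_hasDerivAt p.1 ((hasDerivAt_id p.1).prodMk (hasDerivAt_const p.1 p.2))
    simpa [phi] using ((hasDerivAt_pow m p.1).const_mul (b j p.2)).fun_add
      ((hasDerivAt_pow (m + 1) p.1).fun_mul hgj)

/-- The partial derivative of `phi` in `t` in coordinates. -/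
lemma hasDerivAt_phi_snd {K m : ℕ} {b₁ : ℂ → ℂ} {b : Fin K → ℂ → ℂ} {g : Fin K → ℂ × ℂ → ℂ}
    {p : ℂ × ℂ} (hb₁ : DifferentiableAt ℂ b₁ p.2) (hb : ∀ j, DifferentiableAt ℂ (b j) p.2)
    (hg : ∀ j, DifferentiableAt ℂ (g j) p) :
    HasDerivAt (fun z : ℂ => phi K m b₁ b g (p.1, z))
      (Fin.cons (p.1 ^ m * deriv b₁ p.2)
        (Fin.snoc (fun j : Fin K => deriv (b j) p.2 * p.1 ^ m +
          p.1 ^ (m + 1) * fderiv ℂ (g j) p (0, 1)) 1)) p.2 := by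
  rw [hasDerivAt_pi]
  intro i
  refine Fin.cases ?_ (fun i => Fin.lastCases ?_ (fun j => ?_) i) i
  · simpa [phi] using (hb₁.hasDerivAt.const_add 1).const_mul (p.1 ^ m)
  · simpa [phi] using hasDerivAt_id' p.2
  · have hgj : HasDerivAt (fun z : ℂ => g j (p.1, z)) (fderiv ℂ (g j) p (0, 1)) p.2 :=
      (hg j).hasFDerivAt.comp_hasDerivAt p.2 ((hasDerivAt_const p.2 p.1).prodMk (hasDerivAt_id p.2))
    simpa [phi] using ((hb j).hasDerivAt.mul_const (p.1 ^ m)).fun_add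
      (hgj.const_mul (p.1 ^ (m + 1)))

/-- Near a point of analyticity, a function is differentiable. -/
lemma AnalyticAt.eventually_differentiableAt {E F : Type*} [NormedAddCommGroup E]
    [NormedSpace ℂ E] [NormedAddCommGroup F] [NormedSpace ℂ F] [CompleteSpace F] {f : E → F}
    {x : E} (hf : AnalyticAt ℂ f x) : ∀ᶠ y in 𝓝 x, DifferentiableAt ℂ f y :=
  hf.eventually_analyticAt.mono fun _ h => h.differentiableAt

/-- The directional derivatives of an analytic function are continuous. -/
lemma AnalyticAt.continuousAt_fderiv_apply {E F : Type*} [NormedAddCommGroup E]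
    [NormedSpace ℂ E] [NormedAddCommGroup F] [NormedSpace ℂ F] [CompleteSpace F] {f : E → F}
    {x : E} (hf : AnalyticAt ℂ f x) (v : E) : ContinuousAt (fun y => fderiv ℂ f y v) x :=
  hf.fderiv.continuousAt.clm_apply continuousAt_const

/-- Away from `u = 0`, the normalized `∂φ/∂u` tends to `e₁`. -/
lemma tendsto_smul_phiDu {K m : ℕ} (hm : 1 ≤ m) {b₁ : ℂ → ℂ} {b : Fin K → ℂ → ℂ}
    {g : Fin K → ℂ × ℂ → ℂ} (hb₁ : ContinuousAt b₁ 0) (hb₁0 : b₁ 0 = 0)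
    (hb : ∀ j, ContinuousAt (b j) 0) (hb0 : ∀ j, b j 0 = 0)
    (hg : ∀ j, AnalyticAt ℂ (g j) (0, 0)) :
    Tendsto (fun p : ℂ × ℂ => ((m : ℂ) * (1 + b₁ p.2) * p.1 ^ (m - 1))⁻¹ • phiDu K m b₁ b g p)
      (𝓝[{p | p.1 ≠ 0}] (0, 0)) (𝓝 (e₁ K)) := by
  obtain ⟨k, rfl⟩ : ∃ k, m = k + 1 := ⟨m - 1, by omega⟩
  have hk : ((k + 1 : ℕ) : ℂ) ≠ 0 := Nat.cast_ne_zero.2 k.succ_ne_zero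
  have hb₁' : ContinuousAt (fun p : ℂ × ℂ => 1 + b₁ p.2) (0, 0) :=
    continuousAt_const.add (ContinuousAt.comp (f := Prod.snd) hb₁ continuousAt_snd)
  have hne : ∀ᶠ p in 𝓝[{p | p.1 ≠ 0}] ((0, 0) : ℂ × ℂ), 1 + b₁ p.2 ≠ 0 :=
    (hb₁'.eventually_ne (by simp [hb₁0])).filter_mono nhdsWithin_le_nhds
  have hdu : ∀ᶠ p in 𝓝[{p | p.1 ≠ 0}] ((0, 0) : ℂ × ℂ), ∀ j, DifferentiableAt ℂ (g j) p :=
    (eventually_all.2 fun j => (hg j).eventually_differentiableAt).filter_mono nhdsWithin_le_nhds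
  rw [tendsto_pi_nhds]
  intro i
  refine Fin.cases ?_ (fun i => Fin.lastCases ?_ (fun j => ?_) i) i
  · refine tendsto_const_nhds.congr' ?_
    filter_upwards [hne, hdu, self_mem_nhdsWithin] with p h1 h2 (h3 : p.1 ≠ 0)
    rw [phiDu, (hasDerivAt_phi_fst h2).deriv]
    simp only [e₁, Pi.single_eq_same, Pi.smul_apply, Fin.cons_zero, smul_eq_mul,
      Nat.add_sub_cancel]
    field_simp
  · refine tendsto_const_nhds.congr' ?_
    filter_upwards [hdu] with p h2
    rw [phiDu, (hasDerivAt_phi_fst h2).deriv]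
    simp [e₁]
  · have hlim : ContinuousAt (fun p : ℂ × ℂ => (1 + b₁ p.2)⁻¹ * (b j p.2 +
        ((k + 1 : ℕ) : ℂ)⁻¹ * ((k + 1 + 1 : ℕ) * p.1 * g j p +
          p.1 ^ 2 * fderiv ℂ (g j) p (1, 0)))) (0, 0) := by
      have h1 : ContinuousAt (fun p : ℂ × ℂ => b j p.2) (0, 0) :=
        ContinuousAt.comp (f := Prod.snd) (hb j) continuousAt_snd
      have h2 := (hg j).continuousAt_fderiv_apply (1, 0)
      have h3 := (hg j).continuousAt
      have h4 : 1 + b₁ ((0, 0) : ℂ × ℂ).2 ≠ 0 := by simp [hb₁0]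
      fun_prop (disch := exact h4)
    have hlim' := hlim.tendsto.mono_left (nhdsWithin_le_nhds (s := {p | p.1 ≠ 0}))
    simp only [hb0, mul_zero, zero_mul, add_zero, ne_eq, OfNat.ofNat_ne_zero, not_false_eq_true,
      zero_pow] at hlim'
    simp only [e₁, Pi.single_eq_of_ne (Fin.succ_ne_zero _)]
    refine hlim'.congr' ?_
    filter_upwards [hne, hdu, self_mem_nhdsWithin] with p h1 h2 (h3 : p.1 ≠ 0)
    rw [phiDu, (hasDerivAt_phi_fst h2).deriv]
    simp only [Pi.smul_apply, Fin.cons_succ, Fin.snoc_castSucc, smul_eq_mul, Nat.add_sub_cancel]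
    field_simp
    ring

/-- `∂φ/∂t` tends to `e_{N+1}`. -/
lemma tendsto_phiDt {K m : ℕ} (hm : 1 ≤ m) {b₁ : ℂ → ℂ} {b : Fin K → ℂ → ℂ}
    {g : Fin K → ℂ × ℂ → ℂ} (hb₁ : AnalyticAt ℂ b₁ 0) (hb : ∀ j, AnalyticAt ℂ (b j) 0)
    (hg : ∀ j, AnalyticAt ℂ (g j) (0, 0)) :
    Tendsto (phiDt K m b₁ b g) (𝓝 (0, 0)) (𝓝 (eLast K)) := by
  have hsnd : Tendsto Prod.snd (𝓝 ((0, 0) : ℂ × ℂ)) (𝓝 0) := continuousAt_snd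
  have hm0 : m ≠ 0 := by omega
  have hdt : phiDt K m b₁ b g =ᶠ[𝓝 (0, 0)] fun p => Fin.cons (p.1 ^ m * deriv b₁ p.2)
      (Fin.snoc (fun j : Fin K => deriv (b j) p.2 * p.1 ^ m +
        p.1 ^ (m + 1) * fderiv ℂ (g j) p (0, 1)) 1) := by
    filter_upwards [hsnd.eventually hb₁.eventually_differentiableAt,
      hsnd.eventually (eventually_all.2 fun j => (hb j).eventually_differentiableAt),
      eventually_all.2 fun j => (hg j).eventually_differentiableAt] with p h1 h2 h3
    exact (hasDerivAt_phi_snd h1 h2 h3).deriv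
  have hcomp {f : ℂ → ℂ} (hf : AnalyticAt ℂ f 0) :
      ContinuousAt (fun p : ℂ × ℂ => deriv f p.2) (0, 0) :=
    ContinuousAt.comp (g := deriv f) (f := Prod.snd) hf.deriv.continuousAt continuousAt_snd
  refine Tendsto.congr' hdt.symm ?_
  rw [tendsto_pi_nhds]
  intro i
  refine Fin.cases ?_ (fun i => Fin.lastCases ?_ (fun j => ?_) i) i
  · have h1 := hcomp hb₁
    have h : ContinuousAt (fun p : ℂ × ℂ => p.1 ^ m * deriv b₁ p.2) (0, 0) := by fun_prop
    simpa [ContinuousAt, eLast, hm0, Pi.single_apply, Fin.ext_iff] using h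
  · simp [eLast]
  · have h1 := hcomp (hb j)
    have h2 := (hg j).continuousAt_fderiv_apply (0, 1)
    have h : ContinuousAt (fun p : ℂ × ℂ => deriv (b j) p.2 * p.1 ^ m +
        p.1 ^ (m + 1) * fderiv ℂ (g j) p (0, 1)) (0, 0) := by fun_prop
    simpa [ContinuousAt, eLast, hm0, Pi.single_apply, Fin.ext_iff, j.isLt.ne] using h

/-- Away from `u = 0`, the normalized secant `φ(u,t) - t e_{N+1}` tends to `e₁`. -/
lemma tendsto_smul_phi_sub {K m : ℕ} {b₁ : ℂ → ℂ} {b : Fin K → ℂ → ℂ}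
    {g : Fin K → ℂ × ℂ → ℂ} (hb₁ : ContinuousAt b₁ 0) (hb₁0 : b₁ 0 = 0)
    (hb : ∀ j, ContinuousAt (b j) 0) (hb0 : ∀ j, b j 0 = 0)
    (hg : ∀ j, ContinuousAt (g j) (0, 0)) :
    Tendsto (fun p : ℂ × ℂ => (p.1 ^ m * (1 + b₁ p.2))⁻¹ •
        (phi K m b₁ b g p - p.2 • eLast K))
      (𝓝[{p | p.1 ≠ 0}] (0, 0)) (𝓝 (e₁ K)) := by
  have hb₁' : ContinuousAt (fun p : ℂ × ℂ => 1 + b₁ p.2) (0, 0) :=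
    continuousAt_const.add (ContinuousAt.comp (f := Prod.snd) hb₁ continuousAt_snd)
  have hne : ∀ᶠ p in 𝓝[{p | p.1 ≠ 0}] ((0, 0) : ℂ × ℂ), 1 + b₁ p.2 ≠ 0 :=
    (hb₁'.eventually_ne (by simp [hb₁0])).filter_mono nhdsWithin_le_nhds
  rw [tendsto_pi_nhds]
  intro i
  refine Fin.cases ?_ (fun i => Fin.lastCases ?_ (fun j => ?_) i) i
  · refine tendsto_const_nhds.congr' ?_
    filter_upwards [hne, self_mem_nhdsWithin] with p h1 (h3 : p.1 ≠ 0)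
    simp only [phi, e₁, eLast, Pi.smul_apply, Pi.sub_apply, Fin.cons_zero, Pi.single_eq_same,
      Pi.single_eq_of_ne (Fin.last_pos' (n := K + 1)).ne, smul_eq_mul, mul_zero, sub_zero]
    field_simp
  · refine tendsto_const_nhds.congr fun p => ?_
    simp [phi, e₁, eLast]
  · have hlim : ContinuousAt (fun p : ℂ × ℂ => (1 + b₁ p.2)⁻¹ * (b j p.2 + p.1 * g j p))
        (0, 0) := by
      have h1 : ContinuousAt (fun p : ℂ × ℂ => b j p.2) (0, 0) :=
        ContinuousAt.comp (f := Prod.snd) (hb j) continuousAt_snd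
      have h3 := hg j
      have h4 : 1 + b₁ ((0, 0) : ℂ × ℂ).2 ≠ 0 := by simp [hb₁0]
      fun_prop (disch := exact h4)
    have hlim' := hlim.tendsto.mono_left (nhdsWithin_le_nhds (s := {p | p.1 ≠ 0}))
    simp only [hb0, mul_zero, zero_mul, add_zero] at hlim'
    simp only [e₁, Pi.single_eq_of_ne (Fin.succ_ne_zero _)]
    refine hlim'.congr' ?_
    filter_upwards [hne, self_mem_nhdsWithin] with p h1 (h3 : p.1 ≠ 0)
    have hlast : eLast K j.castSucc.succ = 0 := by
      simp [eLast, Fin.ext_iff, j.isLt.ne]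
    simp only [phi, Pi.smul_apply, Pi.sub_apply, hlast, Fin.cons_succ, Fin.snoc_castSucc,
      smul_eq_mul]
    field_simp
    ring

/-- Let `m ≥ 1`, `N = K + 1 ≥ 2`, let `b₁, …, b_N` be holomorphic germs at `0 ∈ ℂ`
vanishing at `0` and `g₂, …, g_N` holomorphic germs at `0 ∈ ℂ²`, and let
`φ(u,t) = (u^m(1+b₁(t)), b₂(t)u^m + u^{m+1}g₂(u,t), …, t)`.  Then for every sequence
`(uₙ,tₙ) → (0,0)` with `uₙ ≠ 0`:
(i) `(m(1+b₁(tₙ))uₙ^{m-1})⁻¹ • (∂φ/∂u)(uₙ,tₙ) → e₁`;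
(ii) `(∂φ/∂t)(uₙ,tₙ) → e_{N+1}`;
(iii) `(uₙ^m(1+b₁(tₙ)))⁻¹ • (φ(uₙ,tₙ) - tₙ e_{N+1}) → e₁`.
(Consequently the limits of the tangent planes `Dφ(uₙ,tₙ)(ℂ²)` equal
`span{e₁, e_{N+1}}`, which contains the tangent line of `{0} × ℂ` at `0` and the limit
of the secant lines joining `φ(uₙ,tₙ)` to `(0,…,0,tₙ)`: Whitney's conditions (a),(b).) -/
theorem whitney_limits_of_deformed_parametrization
    (K m : ℕ) (hK : 1 ≤ K) (hm : 1 ≤ m)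
    (b₁ : ℂ → ℂ) (b : Fin K → ℂ → ℂ) (g : Fin K → ℂ × ℂ → ℂ)
    (hb₁ : AnalyticAt ℂ b₁ 0) (hb₁0 : b₁ 0 = 0)
    (hb : ∀ j, AnalyticAt ℂ (b j) 0) (hb0 : ∀ j, b j 0 = 0)
    (hg : ∀ j, AnalyticAt ℂ (g j) (0, 0))
    (u t : ℕ → ℂ) (hu : ∀ n, u n ≠ 0)
    (hconv : Tendsto (fun n => (u n, t n)) atTop (𝓝 ((0 : ℂ), (0 : ℂ)))) :
    Tendsto (fun n => ((m : ℂ) * (1 + b₁ (t n)) * (u n) ^ (m - 1))⁻¹ •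
        phiDu K m b₁ b g (u n, t n)) atTop (𝓝 (e₁ K)) ∧
    Tendsto (fun n => phiDt K m b₁ b g (u n, t n)) atTop (𝓝 (eLast K)) ∧
    Tendsto (fun n => ((u n) ^ m * (1 + b₁ (t n)))⁻¹ •
        (phi K m b₁ b g (u n, t n) - (t n) • eLast K)) atTop (𝓝 (e₁ K)) := by
  have hconv' : Tendsto (fun n => (u n, t n)) atTop (𝓝[{p | p.1 ≠ 0}] ((0 : ℂ), (0 : ℂ))) :=
    tendsto_nhdsWithin_iff.2 ⟨hconv, Eventually.of_forall hu⟩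
  have hbc (j : Fin K) : ContinuousAt (b j) 0 := (hb j).continuousAt
  have hdu := (tendsto_smul_phiDu hm hb₁.continuousAt hb₁0 hbc hb0 hg).comp hconv'
  have hdt := (tendsto_phiDt hm hb₁ hb hg).comp hconv
  have hsec := (tendsto_smul_phi_sub (m := m) hb₁.continuousAt hb₁0 hbc hb0
    fun j => (hg j).continuousAt).comp hconv'
  exact ⟨by simpa only [Function.comp_def] using hdu, by simpa only [Function.comp_def] using hdt,
    by simpa only [Function.comp_def] using hsec⟩
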